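/- Let 𝒜 be a linearly ordered structure such that either the coinitiality or the cofinality of 𝒜 equals |A| ≥ ℵ₀, let 𝒰 be an ultrafilter on I, and suppose there is a choice function e on the equivalence classes of A^I/𝒰 that is an order-embedding of the ultrapower into the direct power A^I with the pointwise order. Then 𝒰 is |A|⁺-complete; consequently (since an ultrafilter is |A|⁺-complete iff the natural embedding A → A^I/𝒰 is an isomorphism) the natural embedding is an isomorphism. -/

import Mathlib

universe u

/-- The cofinality of a relation `r`: the least cardinality of an `r`-cofinal subset.
With `r = (· ≤ ·)` this is the cofinality; with `r a b := b ≤ a` it is the coinitiality. -/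
noncomputable def rcofin {α : Type u} (r : α → α → Prop) : Cardinal.{u} :=
  ⨅ S : {S : Set α // ∀ a : α, ∃ b ∈ S, r a b}, Cardinal.mk S.1

open Cardinal Set in
/-- An omega-Jonsson function (Erdos-Hajnal, Galvin-Prikry). -/
theorem exists_jonsson (W : Type u) :
    ∃ F : ℕ → (ℕ → W) → W, ∀ B : Set W, #B = #W →
      ∀ w, ∃ n t, (∀ m, t m ∈ B) ∧ F n t = w := by
  classical
  rcases isEmpty_or_nonempty W with hW | hW
  · exact ⟨fun n t => t 0, fun B _ w => isEmptyElim w⟩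
  let f : ℕ → (ℕ → W) → W := fun n x =>
    (Quotient.out (s := Filter.germSetoid Filter.atTop W) (Quotient.mk _ x)) n
  have hf : ∀ x : ℕ → W, ∃ N, ∀ y : ℕ → W, (∃ M, ∀ n ≥ M, y n = x n) →
      ∀ n ≥ N, f n y = x n := by
    intro x
    have h1 := Quotient.mk_out (s := Filter.germSetoid Filter.atTop W) x
    have h2 : ∀ᶠ n in Filter.atTop, f n x = x n := h1
    obtain ⟨N, hN⟩ := Filter.eventually_atTop.1 h2
    refine ⟨N, fun y ⟨M, hM⟩ n hn => ?_⟩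
    have h3 : (Quotient.mk (Filter.germSetoid Filter.atTop W) y) = Quotient.mk _ x :=
      Quotient.sound (Filter.eventually_atTop.2 ⟨M, hM⟩)
    have : f n y = f n x := by simp only [f, h3]
    rw [this, hN n hn]
  have key : ∃ A0 : Set W, #A0 = #W ∧ ∀ B ⊆ A0, #B = #W →
      ∀ a ∈ A0, ∃ n t, (∀ m, t m ∈ B) ∧ f n t = a := by
    by_contra hcon
    push Not at hcon
    choose! B hBA hB a ha hne using hcon
    let S : ℕ → Set W := fun n => B^[n] univ
    have hS : ∀ n, S (n+1) = B (S n) := fun n => Function.iterate_succ_apply' B n univ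
    have hc : ∀ n, #(S n) = #W := by
      intro n
      induction n with
      | zero => simp [S]
      | succ n ih => rw [hS]; exact hB _ ih
    have hanti : Antitone S := antitone_nat_of_succ_le fun n => by
      rw [hS]; exact hBA _ (hc n)
    obtain ⟨N, hN⟩ := hf (fun n => a (S n))
    have h1 := hN (fun n => if n ≤ N then a (S (N+1)) else a (S n))
      ⟨N+1, fun n hn => by simp [show ¬ n ≤ N by omega]⟩ N le_rfl
    refine hne (S N) (hc N) N _ ?_ h1
    intro m
    rw [← hS]
    split_ifs with h
    · exact ha _ (hc _)
    · exact hanti (show N+1 ≤ m by omega) (ha _ (hc _))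
  obtain ⟨A0, hA0, hJ⟩ := key
  obtain ⟨g⟩ := Cardinal.eq.1 hA0
  refine ⟨fun n t => if h : f n (fun m => (g.symm (t m) : W)) ∈ A0 then g ⟨_, h⟩ else t 0, ?_⟩
  intro B hB w
  have hinj : Function.Injective (fun w : W => (g.symm w : W)) :=
    Subtype.val_injective.comp g.symm.injective
  obtain ⟨n, t, ht, hft⟩ := hJ ((fun w : W => (g.symm w : W)) '' B)
    (by rintro _ ⟨w, _, rfl⟩; exact (g.symm w).2)
    (by rw [Cardinal.mk_image_eq hinj, hB]) (g.symm w) (g.symm w).2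
  choose s hs hst using ht
  refine ⟨n, s, hs, ?_⟩
  have : (fun m => (g.symm (s m) : W)) = t := funext hst
  simp only [this, hft]
  simp

open Cardinal Set Filter in
theorem main_wo {W I : Type u} [LinearOrder W] [WellFoundedLT W] (U : Ultrafilter I)
    (hinf : ℵ₀ ≤ #W)
    (hb : ∀ S : Set W, #S < #W → ∃ u, ∀ v ∈ S, v < u)
    (hs : ∀ w : W, #(Iio w) < #W)
    (p : (I → W) → I → W) (hp : ∀ x, ∀ᶠ i in (U : Filter I), p x i = x i)
    (hm : ∀ x y : I → W, (∀ᶠ i in (U : Filter I), x i ≤ y i) → ∀ i, p x i ≤ p y i)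
    (h : I → W) : ∃ w, ∀ᶠ i in (U : Filter I), h i = w := by
  classical
  have hone : ∀ w : W, ∃ u, w < u := by
    intro w
    obtain ⟨u, hu⟩ := hb {w} (lt_of_lt_of_le (by simp) hinf)
    exact ⟨u, hu w rfl⟩
  have hleast : ∀ w : W, ∃ u, w < u ∧ ∀ v, w < v → u ≤ v := by
    intro w
    have hne : (Ioi w).Nonempty := hone w
    exact ⟨_, WellFounded.min_mem wellFounded_lt _ hne,
        fun y hy => not_lt.1 (WellFounded.not_lt_min wellFounded_lt _ hy)⟩
  choose sc hsc hscl using hleast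
  -- unbounded coordinates
  have hunb : ∀ᶠ i in (U : Filter I), ∀ w, ∃ x, w ≤ p x i := by
    by_contra hcon
    have hcon := Ultrafilter.eventually_not.2 hcon
    have : ∀ i, ∃ d, (¬ ∀ w, ∃ x, w ≤ p x i) → ∀ x, p x i < d := by
      intro i
      by_cases h0 : ∀ w, ∃ x, w ≤ p x i
      · exact ⟨h i, fun h1 => absurd h0 h1⟩
      · push Not at h0
        obtain ⟨d, hd⟩ := h0
        exact ⟨d, fun _ => hd⟩
    choose d hd using this
    obtain ⟨i, h1, h2⟩ := (hcon.and (hp d)).exists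
    exact (hd i h1 d).ne h2
  -- constants are cofinal
  have hcof : ∀ x : I → W, ∃ w, ∀ᶠ i in (U : Filter I), x i ≤ w := by
    by_contra hcon
    push Not at hcon
    obtain ⟨k, hk⟩ := hcon
    have hk' : ∀ w, ∀ᶠ i in (U : Filter I), w < k i := hk
    obtain ⟨i, hi⟩ := hunb.exists
    choose x hx using hi
    have : ∀ j, ∃ u, ∀ v ∈ (fun w => x w j) '' Iio (k j), v < u := fun j =>
      hb _ (lt_of_le_of_lt mk_image_le (hs _))
    choose g hg using this
    have h1 : ∀ w, w ≤ p g i := fun w => (hx w).trans (hm _ _ (by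
      filter_upwards [hk' w] with j hj
      exact (hg j _ ⟨w, hj, rfl⟩).le) i)
    exact absurd (h1 (sc (p g i))) (not_le.2 (hsc _))
  -- countable completeness
  have hsig : ∀ P : ℕ → I → Prop, (∀ n, ∀ᶠ i in (U : Filter I), P n i) →
      ∀ᶠ i in (U : Filter I), ∀ n, P n i := by
    intro P hP
    by_contra hcon
    have hcon := Ultrafilter.eventually_not.2 hcon
    have : ∀ i, ∃ n, (¬ ∀ n, P n i) → ¬ P n i := by
      intro i
      by_cases h0 : ∀ n, P n i
      · exact ⟨0, fun h1 => absurd h0 h1⟩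
      · push Not at h0
        obtain ⟨d, hd⟩ := h0
        exact ⟨d, fun _ => hd⟩
    choose f hf using this
    have hfn : ∀ n, ∀ᶠ i in (U : Filter I), n < f i := by
      intro n
      have h1 : ∀ᶠ i in (U : Filter I), ∀ m ∈ Finset.range (n+1), P m i :=
        (Filter.eventually_all_finset _).2 fun m _ => hP m
      filter_upwards [h1, hcon] with i h2 h3
      by_contra h4
      exact hf i h3 (h2 _ (by simp; omega))
    obtain ⟨w0⟩ : Nonempty W := by
      rw [← mk_ne_zero_iff]
      exact (lt_of_lt_of_le aleph0_pos hinf).ne'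
    let s : ℕ → W := fun n => sc^[n] w0
    have hss : StrictMono s := strictMono_nat_of_lt_succ fun n => by
      simp only [s, Function.iterate_succ_apply']; exact hsc _
    -- pointwise supremum
    have hub : ∀ i, ∃ d, IsLeast {d | ∀ n, p (fun _ => s n) i ≤ d} d := by
      intro i
      have hne : {d | ∀ n, p (fun _ => s n) i ≤ d}.Nonempty :=
        ⟨p (fun j => s (f j)) i, fun n => hm _ _ (by
          filter_upwards [hfn n] with j hj
          exact hss.monotone hj.le) i⟩
      exact ⟨_, WellFounded.min_mem wellFounded_lt _ hne,
        fun y hy => not_lt.1 (WellFounded.not_lt_min wellFounded_lt _ hy)⟩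
    choose d hd using hub
    have hle : ∀ y : I → W, (∀ n, ∀ᶠ i in (U : Filter I), s n ≤ y i) →
        ∀ᶠ i in (U : Filter I), d i ≤ y i := by
      intro y hy
      filter_upwards [hp y] with i hi
      rw [← hi]
      exact (hd i).2 fun n => hm _ _ (hy n) i
    have hge : ∀ n, ∀ᶠ i in (U : Filter I), s n ≤ d i := by
      intro n
      filter_upwards [hp (fun _ => s n)] with i hi
      rw [← hi]; exact (hd i).1 n
    have hdf := hle (fun i => s (f i)) fun n => by
      filter_upwards [hfn n] with j hj
      exact hss.monotone hj.le
    let q : I → ℕ := fun i => sInf {n | d i ≤ s n}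
    have hq : ∀ᶠ i in (U : Filter I), d i ≤ s (q i) := by
      filter_upwards [hdf] with i hi
      exact Nat.sInf_mem (s := {n | d i ≤ s n}) ⟨f i, hi⟩
    have hqn : ∀ n, ∀ᶠ i in (U : Filter I), n ≤ q i := by
      intro n
      filter_upwards [hq, hge n] with i h1 h2
      exact hss.le_iff_le.1 (h2.trans h1)
    have h5 := hle (fun i => s (q i - 1)) fun n => by
      filter_upwards [hqn (n+1)] with i hi
      exact hss.monotone (by omega)
    obtain ⟨i, h6, h7⟩ := (h5.and (hqn 1)).exists
    have h8 : q i ≤ q i - 1 := Nat.sInf_le (s := {n | d i ≤ s n}) h6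
    omega
  -- least constant bounds
  let l : (I → W) → W → Prop := fun x w => ∀ᶠ i in (U : Filter I), x i ≤ w
  let Bd : I → W → Set W := fun i u => {w | ∀ x, p x i ≤ u → l x w}
  let b : I → W → W := fun i u => if hh : (Bd i u).Nonempty then
    WellFounded.min wellFounded_lt (Bd i u) hh else u
  have hbmem : ∀ i, (∀ w, ∃ x, w ≤ p x i) → ∀ u, b i u ∈ Bd i u := by
    intro i hi u
    have hne : (Bd i u).Nonempty := by
      obtain ⟨x, hx⟩ := hi (sc u)
      obtain ⟨w, hw⟩ := hcof x
      refine ⟨w, fun y hy => ?_⟩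
      have : ∀ᶠ j in (U : Filter I), y j ≤ x j := by
        by_contra hc
        have hc := Ultrafilter.eventually_not.2 hc
        have h1 := hm x y (hc.mono fun j hj => (not_le.1 hj).le) i
        exact absurd ((hsc u).trans_le (hx.trans (h1.trans hy))) (lt_irrefl _)
      filter_upwards [this, hw] with j h1 h2
      exact h1.trans h2
    simp only [b, dif_pos hne]
    exact WellFounded.min_mem wellFounded_lt _ hne
  have hbig : ∀ i, (∀ w, ∃ x, w ≤ p x i) → #(range (b i)) = #W := by
    intro i hi
    refine le_antisymm (mk_set_le _) (not_lt.1 fun hlt => ?_)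
    obtain ⟨u, hu⟩ := hb _ hlt
    have h1 := hbmem i hi (p (fun _ => u) i) (fun _ => u) le_rfl
    obtain ⟨j, hj⟩ := h1.exists
    exact absurd (hu _ ⟨_, rfl⟩) (not_lt.2 hj)
  have hconst : ∀ u : I → W, ∃ w, ∀ᶠ i in (U : Filter I), b i (u i) = w := by
    intro u
    have hset : ∀ᶠ i in (U : Filter I), Bd i (u i) = {w | l u w} := by
      filter_upwards [hp u, hp (fun i => sc (u i))] with i h1 h2
      ext w
      constructor
      · intro hw
        exact hw u h1.le
      · intro hw x hx
        have : ∀ᶠ j in (U : Filter I), x j ≤ u j := by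
          by_contra hc
          have hc := Ultrafilter.eventually_not.2 hc
          have h3 := hm (fun j => sc (u j)) x
            (hc.mono fun j hj => hscl _ _ (not_le.1 hj)) i
          rw [h2] at h3
          exact absurd ((hsc (u i)).trans_le (h3.trans hx)) (lt_irrefl _)
        filter_upwards [this, hw] with j h1 h2
        exact h1.trans h2
    obtain ⟨i0, hi0⟩ := hset.exists
    obtain ⟨w, hw⟩ := hcof u
    have hne : {w | l u w}.Nonempty := ⟨w, hw⟩
    refine ⟨WellFounded.min wellFounded_lt _ hne, ?_⟩
    filter_upwards [hset] with i hi
    simp only [b, hi, dif_pos hne]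
  obtain ⟨F, hF⟩ := exists_jonsson W
  have hch : ∀ i, ∃ n, ∃ t : ℕ → W, (∀ w, ∃ x, w ≤ p x i) →
      F n (fun m => b i (t m)) = h i := by
    intro i
    by_cases h0 : ∀ w, ∃ x, w ≤ p x i
    · obtain ⟨n, t, ht, hFt⟩ := hF _ (hbig i h0) (h i)
      choose t' ht' using ht
      refine ⟨n, t', fun _ => ?_⟩
      rw [← hFt]; congr 1; exact funext ht'
    · exact ⟨0, fun _ => h i, fun h1 => absurd h1 h0⟩
  choose n t ht using hch
  choose w hw using fun m => hconst (fun i => t i m)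
  have hall := hsig _ hw
  have hn : ∃ N, ∀ᶠ i in (U : Filter I), n i = N := by
    by_contra hc
    push Not at hc
    have := hsig (fun N i => ¬ n i = N) hc
    obtain ⟨i, hi⟩ := this.exists
    exact hi _ rfl
  obtain ⟨N, hN⟩ := hn
  refine ⟨F N w, ?_⟩
  filter_upwards [hall, hN, hunb] with i h1 h2 h3
  rw [← ht i h3, h2]
  congr 1
  exact (funext h1)

open Cardinal Set Filter in
theorem main_lin {A I : Type u} [LinearOrder A] (U : Ultrafilter I)
    (hinf : ℵ₀ ≤ #A)
    (hb : ∀ S : Set A, #S < #A → ∃ u, ∀ v ∈ S, v < u)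
    (p : (I → A) → I → A) (hp : ∀ x, ∀ᶠ i in (U : Filter I), p x i = x i)
    (hm : ∀ x y : I → A, (∀ᶠ i in (U : Filter I), x i ≤ y i) → ∀ i, p x i ≤ p y i)
    (h : I → A) : ∃ w, ∀ᶠ i in (U : Filter I), h i = w := by
  classical
  let W := (#A).ord.ToType
  have hW : #W = #A := mk_ord_toType _
  have hs : ∀ w : W, #(Iio w) < #W := fun w => by
    rw [hW]; exact mk_Iio_toType_ord_lt w
  have hs' : ∀ w : W, #(Iio w) < #A := fun w => (hs w).trans_eq hW
  obtain ⟨g⟩ := Cardinal.eq.1 hW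
  have hex : ∀ (w : W) (a : (v : W) → v < w → A), ∃ x, ∀ v (hv : v < w), a v hv < x ∧ g v < x := by
    intro w a
    obtain ⟨x, hx⟩ := hb (range (fun v : Iio w => a v.1 v.2) ∪ range (fun v : Iio w => g v.1)) (by
      refine (mk_union_le _ _).trans_lt (add_lt_of_lt hinf ?_ ?_)
      · exact mk_range_le.trans_lt (hs' w)
      · exact mk_range_le.trans_lt (hs' w))
    exact ⟨x, fun v hv => ⟨hx _ (Or.inl ⟨⟨v, hv⟩, rfl⟩), hx _ (Or.inr ⟨⟨v, hv⟩, rfl⟩)⟩⟩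
  choose c hc using hex
  let a : W → A := WellFounded.fix (C := fun _ => A) (wellFounded_lt (α := W)) c
  have ha : ∀ w, a w = c w (fun v _ => a v) := fun w => WellFounded.fix_eq _ _ _
  have hlt : ∀ v w, v < w → a v < a w ∧ g v < a w := by
    intro v w hvw
    rw [ha w]
    exact hc w (fun v _ => a v) v hvw
  have hmono : StrictMono a := fun v w hvw => (hlt v w hvw).1
  have : NoMaxOrder W := Cardinal.noMaxOrder hinf
  have hex2 : ∀ x : A, ∃ w, x ≤ a w ∧ ∀ v, x ≤ a v → w ≤ v := by
    intro x
    have hne : {w | x ≤ a w}.Nonempty := by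
      obtain ⟨w, hw⟩ := exists_gt (g.symm x)
      have := (hlt _ _ hw).2
      rw [Equiv.apply_symm_apply] at this
      exact ⟨w, this.le⟩
    exact ⟨_, WellFounded.min_mem wellFounded_lt _ hne,
        fun y hy => not_lt.1 (WellFounded.not_lt_min wellFounded_lt {w | x ≤ a w} hy)⟩
  choose r hr hrl using hex2
  have hra : ∀ w, r (a w) = w := fun w =>
    le_antisymm (hrl _ _ le_rfl) (hmono.le_iff_le.1 (hr _))
  have hrm : Monotone r := fun x y hxy => hrl _ _ (hxy.trans (hr _))
  obtain ⟨w, hw⟩ := main_wo (W := W) U (hinf.trans_eq hW.symm)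
    (by
      intro S hS
      obtain ⟨x, hx⟩ := hb (a '' S) (mk_image_le.trans_lt (hS.trans_eq hW))
      exact ⟨r x, fun v hv => hmono.lt_iff_lt.1 ((hx _ ⟨v, hv, rfl⟩).trans_le (hr x))⟩)
    hs (fun x i => r (p (fun j => a (x j)) i))
    (by
      intro x
      filter_upwards [hp (fun j => a (x j))] with i hi
      rw [hi, hra])
    (by
      intro x y hxy i
      exact hrm (hm _ _ (hxy.mono fun j hj => hmono.monotone hj) i))
    (fun i => g.symm (h i))
  exact ⟨g w, hw.mono fun i hi => by rw [← hi]; simp⟩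

theorem rcofin_bound {A : Type u} (r : A → A → Prop)
    (h : rcofin r = Cardinal.mk A) (S : Set A) (hS : Cardinal.mk S < Cardinal.mk A) :
    ∃ u, ∀ v ∈ S, ¬ r u v := by
  by_contra hc
  push Not at hc
  have : rcofin r ≤ Cardinal.mk S :=
    ciInf_le' (fun S : {S : Set A // ∀ a : A, ∃ b ∈ S, r a b} => Cardinal.mk S.1) ⟨S, hc⟩
  exact absurd (h ▸ this) (not_le.2 hS)

theorem stmt18 {A : Type u} [LinearOrder A] {I : Type u} (U : Ultrafilter I)
    (hA : Cardinal.aleph0 ≤ Cardinal.mk A)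
    (hcc : rcofin (fun a b : A => b ≤ a) = Cardinal.mk A ∨
      rcofin ((· ≤ ·) : A → A → Prop) = Cardinal.mk A)
    (e : Filter.Germ (U : Filter I) A → (I → A))
    (hrep : ∀ x : Filter.Germ (U : Filter I) A, ((e x : I → A) : Filter.Germ (U : Filter I) A) = x)
    (hemb : ∀ x y : Filter.Germ (U : Filter I) A, x ≤ y ↔ e x ≤ e y) :
    (∀ S : Set (Set I), Cardinal.mk S < Order.succ (Cardinal.mk A) →
      (∀ X ∈ S, X ∈ U) → ⋂₀ S ∈ U) ∧
    Function.Bijective (fun a : A => ((fun _ => a : I → A) : Filter.Germ (U : Filter I) A)) := by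
  classical
  have hp : ∀ x : I → A, ∀ᶠ i in (U : Filter I), e (x : Filter.Germ (U : Filter I) A) i = x i :=
    fun x => Filter.Germ.coe_eq.1 (hrep x)
  have hm : ∀ x y : I → A, (∀ᶠ i in (U : Filter I), x i ≤ y i) →
      ∀ i, e (x : Filter.Germ (U : Filter I) A) i ≤ e (y : Filter.Germ (U : Filter I) A) i :=
    fun x y hxy => (hemb _ _).1 (Filter.Germ.coe_le.2 hxy)
  have key : ∀ h : I → A, ∃ w, ∀ᶠ i in (U : Filter I), h i = w := by
    intro h
    rcases hcc with hcc | hcc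
    · exact main_lin (A := Aᵒᵈ) U hA
        (fun S hS => by
          obtain ⟨u, hu⟩ := rcofin_bound _ hcc S hS
          exact ⟨u, fun v hv => not_le.1 (hu v hv)⟩)
        (fun x => e (Filter.Germ.ofFun (α := I) (β := A) x))
        (fun x => hp x) (fun x y hxy i => hm y x hxy i) h
    · exact main_lin U hA
        (fun S hS => by
          obtain ⟨u, hu⟩ := rcofin_bound _ hcc S hS
          exact ⟨u, fun v hv => not_le.1 (hu v hv)⟩)
        (fun x => e ((x : I → A) : Filter.Germ (U : Filter I) A)) hp hm h
  refine ⟨?_, ?_, ?_⟩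
  · intro S hS hSU
    by_contra hcon
    have hcon : ∀ᶠ i in (U : Filter I), ¬ i ∈ ⋂₀ S := Ultrafilter.eventually_not.2 hcon
    rw [Order.lt_succ_iff] at hS
    obtain ⟨g⟩ := hS
    obtain ⟨i0, hi0⟩ := hcon.exists
    have hch : ∀ i, ∃ X : S, (¬ i ∈ ⋂₀ S) → i ∉ X.1 := by
      intro i
      by_cases h0 : i ∈ ⋂₀ S
      · simp only [Set.mem_sInter, not_forall] at hi0
        obtain ⟨X, hX, _⟩ := hi0
        exact ⟨⟨X, hX⟩, fun h1 => absurd h0 h1⟩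
      · simp only [Set.mem_sInter, not_forall] at h0
        obtain ⟨X, hX, hiX⟩ := h0
        exact ⟨⟨X, hX⟩, fun _ => hiX⟩
    choose X hX using hch
    obtain ⟨w, hw⟩ := key (fun i => g (X i))
    obtain ⟨j, hj⟩ := hw.exists
    have hXj : ∀ᶠ i in (U : Filter I), i ∈ (X j).1 := hSU _ (X j).2
    obtain ⟨i, ⟨h1, h2⟩, h3⟩ := ((hw.and hcon).and hXj).exists
    have h4 : X i = X j := g.injective (h1.trans hj.symm)
    exact hX i h2 (h4 ▸ h3)
  · intro a b hab
    have h1 : ∀ᶠ i in (U : Filter I), a = b := Filter.Germ.coe_eq.1 hab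
    obtain ⟨_, h2⟩ := h1.exists
    exact h2
  · intro x
    induction x using Filter.Germ.inductionOn with
    | _ f =>
      obtain ⟨w, hw⟩ := key f
      exact ⟨w, Filter.Germ.coe_eq.2 (hw.mono fun i hi => hi.symm)⟩
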